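/- arXiv:1102.0250 — 5 statements merged into one kernel-verified Lean document; each statement's English description precedes it below -/
import Mathlib

section
/- Let κ be a Markov kernel from a measurable space 𝒳 to a measurable space 𝒴 and let λ : 𝒳 → [0,∞) be measurable. Define the capacity–cost function C(a) = sup { I(P,κ) : P a probability measure on 𝒳 with ∫ λ dP ≤ a }, where I(P,κ) = D(P ⊗ κ ‖ P × (κ∘P)) is the mutual information of input distribution P through κ. Then C is concave: for all a₁, a₂ ≥ 0 and t ∈ [0,1], C(t·a₁ + (1−t)·a₂) ≥ t·C(a₁) + (1−t)·C(a₂). -/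
open MeasureTheory ProbabilityTheory
open scoped ENNReal

/- The Kullback–Leibler divergence `D(P‖Q)`: equal to `∫ log (dP/dQ) dP` when `P ≪ Q` and
the log-likelihood ratio is integrable (equivalently, `D(P‖Q) < ∞`), and `∞` otherwise. -/
open scoped Classical in
noncomputable def klDiv {Ω : Type*} [MeasurableSpace Ω] (P Q : Measure Ω) : ℝ≥0∞ :=
  if P ≪ Q ∧ Integrable (fun ω => Real.log (P.rnDeriv Q ω).toReal) P
  then ENNReal.ofReal (∫ ω, Real.log (P.rnDeriv Q ω).toReal ∂P)
  else ⊤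

theorem aux_rnDeriv_le {Ω : Type*} [MeasurableSpace Ω] (P Q : Measure Ω)
    [IsProbabilityMeasure P] [IsProbabilityMeasure Q] (c : ℝ≥0∞) (h : P ≤ c • Q) :
    ∀ᵐ x ∂Q, P.rnDeriv Q x ≤ c := by
  refine ae_le_of_forall_setLIntegral_le_of_sigmaFinite (Measure.measurable_rnDeriv _ _) ?_
  intro s hs _
  rw [setLIntegral_const]
  exact (Measure.setLIntegral_rnDeriv_le s).trans (by simpa using h s)

theorem aux_integrable_llr {Ω : Type*} [MeasurableSpace Ω] (P Q : Measure Ω)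
    [IsProbabilityMeasure P] [IsProbabilityMeasure Q] (c : ℝ≥0∞) (hc : c ≠ ⊤) (h : P ≤ c • Q) :
    Integrable (llr P Q) P := by
  have hac : P ≪ Q := Measure.absolutelyContinuous_of_le_smul h
  rw [← InformationTheory.integrable_klFun_rnDeriv_iff hac]
  obtain ⟨B, hB⟩ := (isCompact_Icc (a := (0:ℝ)) (b := c.toReal)).exists_bound_of_continuousOn
    InformationTheory.continuous_klFun.continuousOn
  refine Integrable.of_bound (C := B) ?_ ?_
  · exact (InformationTheory.measurable_klFun.comp
      (Measure.measurable_rnDeriv _ _).ennreal_toReal).aestronglyMeasurable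
  · filter_upwards [aux_rnDeriv_le P Q c h] with x hx
    exact hB _ ⟨ENNReal.toReal_nonneg, ENNReal.toReal_mono hc hx⟩

theorem aux_llr_nonneg {Ω : Type*} [MeasurableSpace Ω] (P Q : Measure Ω)
    [IsProbabilityMeasure P] [IsProbabilityMeasure Q] (hac : P ≪ Q)
    (hi : Integrable (llr P Q) P) : 0 ≤ ∫ x, llr P Q x ∂P := by
  simpa using InformationTheory.integral_llr_add_sub_measure_univ_nonneg hac hi

theorem aux_compProd_withDensity {𝒳 𝒴 : Type*} [MeasurableSpace 𝒳] [MeasurableSpace 𝒴]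
    (κ : Kernel 𝒳 𝒴) [IsMarkovKernel κ] (P : Measure 𝒳) [SFinite P] (g : 𝒳 → ℝ≥0∞)
    (hg : Measurable g) :
    (P.withDensity g) ⊗ₘ κ = (P ⊗ₘ κ).withDensity (fun z => g z.1) := by
  ext s hs
  have hg' : Measurable (fun z : 𝒳 × 𝒴 => g z.1) := hg.comp measurable_fst
  rw [Measure.compProd_apply hs, withDensity_apply _ hs, ← lintegral_indicator hs,
    Measure.lintegral_compProd (hg'.indicator hs),
    lintegral_withDensity_eq_lintegral_mul _ hg (Kernel.measurable_kernel_prodMk_left hs)]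
  refine lintegral_congr fun x => ?_
  have : ∀ y, s.indicator (fun z : 𝒳 × 𝒴 => g z.1) (x, y)
      = g x * (Prod.mk x ⁻¹' s).indicator 1 y := by
    intro y
    by_cases hy : (x, y) ∈ s <;> simp [hy]
  simp_rw [this]
  rw [lintegral_const_mul _ (measurable_one.indicator (measurable_prodMk_left hs)),
    lintegral_indicator_one (measurable_prodMk_left hs)]
  rfl

theorem aux_key {𝒳 𝒴 : Type*} [MeasurableSpace 𝒳] [MeasurableSpace 𝒴]
    (κ : Kernel 𝒳 𝒴) [IsMarkovKernel κ] (P P₁ : Measure 𝒳) [IsProbabilityMeasure P]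
    [IsProbabilityMeasure P₁] (c : ℝ≥0∞) (hc : c ≠ ⊤) (hle : P₁ ≤ c • P)
    (hac : P ⊗ₘ κ ≪ P.prod (P.bind κ))
    (hi : Integrable (llr (P ⊗ₘ κ) (P.prod (P.bind κ))) (P ⊗ₘ κ)) :
    Integrable (llr (P ⊗ₘ κ) (P.prod (P.bind κ))) (P₁ ⊗ₘ κ) ∧
    0 ≤ ∫ z, llr (P ⊗ₘ κ) (P.prod (P.bind κ)) z ∂(P₁ ⊗ₘ κ) ∧
    klDiv (P₁ ⊗ₘ κ) (P₁.prod (P₁.bind κ)) ≤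
      ENNReal.ofReal (∫ z, llr (P ⊗ₘ κ) (P.prod (P.bind κ)) z ∂(P₁ ⊗ₘ κ)) := by
  have hAle : P₁ ⊗ₘ κ ≤ c • (P ⊗ₘ κ) := by
    rw [← Measure.compProd_smul_left]
    refine Measure.le_iff.2 fun s hs => ?_
    have : SFinite (c • P) := inferInstance
    rw [Measure.compProd_apply hs, Measure.compProd_apply hs]
    exact lintegral_mono' hle le_rfl
  have hQ1 : P₁.bind κ = (P₁ ⊗ₘ κ).map Prod.snd := (Measure.snd_compProd P₁ κ).symm
  have hQ0 : P.bind κ = (P ⊗ₘ κ).map Prod.snd := (Measure.snd_compProd P κ).symm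
  have hQle : P₁.bind κ ≤ c • P.bind κ := by
    rw [hQ1, hQ0, ← Measure.map_smul]
    exact Measure.map_mono hAle measurable_snd
  have hpQ : IsProbabilityMeasure (P.bind κ) := inferInstance
  have hpQ1 : IsProbabilityMeasure (P₁.bind κ) := inferInstance
  generalize P.bind κ = Q at *
  generalize P₁.bind κ = Q₁ at *
  have hPac : P₁ ≪ P := Measure.absolutelyContinuous_of_le_smul hle
  have hQac : Q₁ ≪ Q := Measure.absolutelyContinuous_of_le_smul hQle
  have hiA : Integrable (llr (P ⊗ₘ κ) (P.prod Q)) (P₁ ⊗ₘ κ) :=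
    (hi.smul_measure hc).mono_measure hAle
  set A := P₁ ⊗ₘ κ with hA
  set f := (P ⊗ₘ κ).rnDeriv (P.prod Q) with hf
  have hfm : Measurable f := Measure.measurable_rnDeriv _ _
  have hgm : Measurable (P₁.rnDeriv P) := Measure.measurable_rnDeriv _ _
  have hhm : Measurable (Q₁.rnDeriv Q) := Measure.measurable_rnDeriv _ _
  have hP1 : P.withDensity (P₁.rnDeriv P) = P₁ := Measure.withDensity_rnDeriv_eq _ _ hPac
  have hQ1' : Q.withDensity (Q₁.rnDeriv Q) = Q₁ := Measure.withDensity_rnDeriv_eq _ _ hQac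
  have hAf : A = (P₁.prod Q).withDensity f := by
    have e1 : P₁.prod Q = (P.prod Q).withDensity (fun z => P₁.rnDeriv P z.1) := by
      conv_lhs => rw [← hP1]
      rw [prod_withDensity_left hgm]
    have hgm' : Measurable (fun z : 𝒳 × 𝒴 => P₁.rnDeriv P z.1) := hgm.comp measurable_fst
    rw [e1, ← withDensity_mul _ hgm' hfm, mul_comm, withDensity_mul _ hfm hgm', hf,
      Measure.withDensity_rnDeriv_eq _ _ hac, ← aux_compProd_withDensity κ P _ hgm, hP1]
  have hB1 : P₁.prod Q₁ = (P₁.prod Q).withDensity (fun z => Q₁.rnDeriv Q z.2) := by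
    conv_lhs => rw [← hQ1']
    rw [prod_withDensity_right hhm]
  have hhm' : Measurable (fun z : 𝒳 × 𝒴 => Q₁.rnDeriv Q z.2) := hhm.comp measurable_snd
  have hAB : A ≪ P₁.prod Q := hAf ▸ withDensity_absolutelyContinuous _ _
  have hBB : P₁.prod Q₁ ≪ P₁.prod Q := hB1 ▸ withDensity_absolutelyContinuous _ _
  have hpos : ∀ᵐ z ∂A, 0 < Q₁.rnDeriv Q z.2 := by
    have := Measure.rnDeriv_pos hQac
    rw [hQ1] at this
    rw [← hQ1] at this
    have h2 : ∀ᵐ y ∂(A.map Prod.snd), 0 < Q₁.rnDeriv Q y := hQ1 ▸ this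
    exact ae_of_ae_map measurable_snd.aemeasurable h2
  have hAB1 : A ≪ P₁.prod Q₁ := by
    intro s hs
    rw [hB1, withDensity_apply_eq_zero hhm'] at hs
    have h1 := hAB hs
    have h2 : A {z | ¬ 0 < Q₁.rnDeriv Q z.2} = 0 := hpos
    refine measure_mono_null ?_ (measure_union_null h1 h2)
    intro z hz
    by_cases h : 0 < Q₁.rnDeriv Q z.2
    · exact Or.inl ⟨h.ne', hz⟩
    · exact Or.inr h
  have r1 : A.rnDeriv (P₁.prod Q) =ᵐ[A] f := by
    refine hAB.ae_eq ?_
    conv_lhs => rw [hAf]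
    exact Measure.rnDeriv_withDensity _ hfm
  have r2 : (P₁.prod Q₁).rnDeriv (P₁.prod Q) =ᵐ[A] fun z => Q₁.rnDeriv Q z.2 := by
    refine hAB.ae_eq ?_
    rw [hB1]
    exact Measure.rnDeriv_withDensity _ hhm'
  have r3 := hAB.ae_eq (Measure.rnDeriv_mul_rnDeriv (κ := P₁.prod Q) hAB1)
  have hllr : llr A (P₁.prod Q) =ᵐ[A] llr (P ⊗ₘ κ) (P.prod Q) := by
    filter_upwards [r1] with z hz
    simp only [llr, hz, hf]
  have hiQ : Integrable (llr Q₁ Q) Q₁ := aux_integrable_llr Q₁ Q c hc hQle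
  have hiQA : Integrable (fun z : 𝒳 × 𝒴 => llr Q₁ Q z.2) A := by
    have : Integrable (llr Q₁ Q) (A.map Prod.snd) := hQ1 ▸ hiQ
    exact this.comp_measurable measurable_snd
  have hintQ : ∫ z, llr Q₁ Q z.2 ∂A = ∫ y, llr Q₁ Q y ∂Q₁ := by
    have : ∫ y, llr Q₁ Q y ∂(A.map Prod.snd) = ∫ z, llr Q₁ Q z.2 ∂A :=
      integral_map measurable_snd.aemeasurable (measurable_llr _ _).aestronglyMeasurable
    rw [← this, ← hQ1]
  have hsub : llr A (P₁.prod Q₁) =ᵐ[A]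
      fun z => llr (P ⊗ₘ κ) (P.prod Q) z - llr Q₁ Q z.2 := by
    filter_upwards [r1, r2, r3, hpos, Measure.rnDeriv_pos hAB1,
      hAB1.ae_le (Measure.rnDeriv_lt_top A (P₁.prod Q₁)),
      hAB.ae_le (Measure.rnDeriv_lt_top (P₁.prod Q₁) (P₁.prod Q))] with z h1 h2 h3 h4 h5 h6 h7
    simp only [llr]
    rw [← hf, ← h1, ← h3, Pi.mul_apply, ENNReal.toReal_mul, h2, Real.log_mul, add_sub_cancel_right]
    · exact (ENNReal.toReal_pos h5.ne' h6.ne).ne'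
    · rw [h2] at h7
      exact (ENNReal.toReal_pos h4.ne' h7.ne).ne'
  have hiB1 : Integrable (llr A (P₁.prod Q₁)) A := (hiA.sub hiQA).congr hsub.symm
  refine ⟨hiA, ?_, ?_⟩
  · rw [← integral_congr_ae hllr]
    exact aux_llr_nonneg _ _ hAB (hiA.congr hllr.symm)
  · unfold klDiv
    rw [if_pos ⟨hAB1, hiB1⟩]
    refine ENNReal.ofReal_le_ofReal ?_
    change ∫ z, llr A (P₁.prod Q₁) z ∂A ≤ _
    rw [integral_congr_ae hsub, integral_sub hiA hiQA, hintQ]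
    linarith [aux_llr_nonneg Q₁ Q hQac hiQ]

theorem aux_concave {𝒳 𝒴 : Type*} [MeasurableSpace 𝒳] [MeasurableSpace 𝒴]
    (κ : Kernel 𝒳 𝒴) [IsMarkovKernel κ] (P₁ P₂ : Measure 𝒳) [IsProbabilityMeasure P₁]
    [IsProbabilityMeasure P₂] (s t : ℝ) (hs : 0 < s) (ht : 0 < t)
    (P : Measure 𝒳) [IsProbabilityMeasure P]
    (hP : P = ENNReal.ofReal t • P₁ + ENNReal.ofReal s • P₂) :
    ENNReal.ofReal t * klDiv (P₁ ⊗ₘ κ) (P₁.prod (P₁.bind κ))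
      + ENNReal.ofReal s * klDiv (P₂ ⊗ₘ κ) (P₂.prod (P₂.bind κ))
      ≤ klDiv (P ⊗ₘ κ) (P.prod (P.bind κ)) := by
  by_cases h : P ⊗ₘ κ ≪ P.prod (P.bind κ) ∧
    Integrable (llr (P ⊗ₘ κ) (P.prod (P.bind κ))) (P ⊗ₘ κ)
  swap
  · have : klDiv (P ⊗ₘ κ) (P.prod (P.bind κ)) = ⊤ := by
      unfold klDiv
      exact if_neg h
    rw [this]
    exact le_top
  have hle : ∀ (r : ℝ) (R : Measure 𝒳), 0 < r → ENNReal.ofReal r • R ≤ P →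
      R ≤ (ENNReal.ofReal r)⁻¹ • P := by
    intro r R hr hR
    have hr0 : ENNReal.ofReal r ≠ 0 := by simpa using hr
    refine Measure.le_iff'.2 fun u => ?_
    have := hR u
    simp only [Measure.smul_apply, smul_eq_mul] at this ⊢
    calc R u = (ENNReal.ofReal r)⁻¹ * (ENNReal.ofReal r * R u) := by
          rw [← mul_assoc, ENNReal.inv_mul_cancel hr0 ENNReal.ofReal_ne_top, one_mul]
      _ ≤ _ := by gcongr
  have htop : ∀ r : ℝ, 0 < r → (ENNReal.ofReal r)⁻¹ ≠ ⊤ := by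
    intro r hr
    simpa using hr
  obtain ⟨i1, n1, k1⟩ := aux_key κ P P₁ _ (htop t ht)
    (hle t P₁ ht (hP ▸ Measure.le_add_right le_rfl)) h.1 h.2
  obtain ⟨i2, n2, k2⟩ := aux_key κ P P₂ _ (htop s hs)
    (hle s P₂ hs (hP ▸ Measure.le_add_left le_rfl)) h.1 h.2
  have hK : klDiv (P ⊗ₘ κ) (P.prod (P.bind κ)) =
      ENNReal.ofReal (∫ z, llr (P ⊗ₘ κ) (P.prod (P.bind κ)) z ∂(P ⊗ₘ κ)) := by
    unfold klDiv
    exact if_pos h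
  have hsum : P ⊗ₘ κ = ENNReal.ofReal t • (P₁ ⊗ₘ κ) + ENNReal.ofReal s • (P₂ ⊗ₘ κ) := by
    rw [← Measure.compProd_smul_left, ← Measure.compProd_smul_left, hP,
      Measure.compProd_add_left]
  rw [hK]
  generalize llr (P ⊗ₘ κ) (P.prod (P.bind κ)) = F at *
  rw [hsum, integral_add_measure (i1.smul_measure ENNReal.ofReal_ne_top)
    (i2.smul_measure ENNReal.ofReal_ne_top), integral_smul_measure, integral_smul_measure,
    ENNReal.toReal_ofReal hs.le, ENNReal.toReal_ofReal ht.le, smul_eq_mul, smul_eq_mul,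
    ENNReal.ofReal_add (by positivity) (by positivity), ENNReal.ofReal_mul ht.le,
    ENNReal.ofReal_mul hs.le]
  gcongr

/-- Concavity of the capacity–cost function.  For a Markov kernel `κ` from `𝒳` to `𝒴` and a
nonnegative measurable cost `λ`, the capacity–cost function
`C(a) = sup { I(P,κ) : P probability measure on 𝒳, ∫ λ dP ≤ a }`
(with `I(P,κ) = D(P ⊗ₘ κ ‖ P × (κ∘P))`, and `sup ∅ = ⊥` in `EReal`) is concave:
for `a₁, a₂ ≥ 0` and `t ∈ [0,1]`, `C(t·a₁ + (1−t)·a₂) ≥ t·C(a₁) + (1−t)·C(a₂)`. -/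
theorem capacityCost_concave
    {𝒳 𝒴 : Type*} [MeasurableSpace 𝒳] [MeasurableSpace 𝒴]
    (κ : Kernel 𝒳 𝒴) [IsMarkovKernel κ]
    (lam : 𝒳 → ℝ) (hlam_meas : Measurable lam) (hlam_nonneg : ∀ x, 0 ≤ lam x)
    (C : ℝ → EReal)
    (hC : ∀ a : ℝ, C a =
      ⨆ (P : Measure 𝒳) (_ : IsProbabilityMeasure P)
        (_ : ∫⁻ x, ENNReal.ofReal (lam x) ∂P ≤ ENNReal.ofReal a),
        ((klDiv (P ⊗ₘ κ) (P.prod (P.bind κ)) : ℝ≥0∞) : EReal))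
    (a₁ a₂ t : ℝ) (ha₁ : 0 ≤ a₁) (ha₂ : 0 ≤ a₂) (ht₀ : 0 ≤ t) (ht₁ : t ≤ 1) :
    (t : EReal) * C a₁ + ((1 - t : ℝ) : EReal) * C a₂ ≤ C (t * a₁ + (1 - t) * a₂) := by
  rcases ht₀.eq_or_lt with rfl | ht
  · simp
  rcases ht₁.eq_or_lt with rfl | ht1
  · simp
  have hs : 0 < 1 - t := by linarith
  have pos : ∀ r : ℝ, 0 < r → (0 : EReal) < (r : EReal) := fun r hr => by exact_mod_cast hr
  have ex : ∀ (r a : ℝ) (b : EReal), 0 < r → b < (r : EReal) * C a →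
      ∃ P : Measure 𝒳, IsProbabilityMeasure P ∧
        ∫⁻ x, ENNReal.ofReal (lam x) ∂P ≤ ENNReal.ofReal a ∧
        b ≤ (r : EReal) * ((klDiv (P ⊗ₘ κ) (P.prod (P.bind κ)) : ℝ≥0∞) : EReal) := by
    intro r a b hr hb
    rw [mul_comm, ← EReal.div_lt_iff (pos r hr) (EReal.coe_ne_top r), hC] at hb
    simp only [lt_iSup_iff] at hb
    obtain ⟨P, hp, hc, hlt⟩ := hb
    rw [EReal.div_lt_iff (pos r hr) (EReal.coe_ne_top r), mul_comm] at hlt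
    exact ⟨P, hp, hc, hlt.le⟩
  refine EReal.add_le_of_forall_lt fun b₁ hb₁ b₂ hb₂ => ?_
  obtain ⟨P₁, hp₁, hc₁, hl₁⟩ := ex t a₁ b₁ ht hb₁
  obtain ⟨P₂, hp₂, hc₂, hl₂⟩ := ex (1 - t) a₂ b₂ hs hb₂
  refine (add_le_add hl₁ hl₂).trans ?_
  have hP : IsProbabilityMeasure (ENNReal.ofReal t • P₁ + ENNReal.ofReal (1 - t) • P₂) := by
    constructor
    simp only [Measure.add_apply, Measure.smul_apply, measure_univ, smul_eq_mul, mul_one]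
    rw [← ENNReal.ofReal_add ht.le hs.le]
    simp
  have key := aux_concave κ P₁ P₂ (1 - t) t hs ht _ rfl
  rw [hC]
  refine le_iSup_of_le (ENNReal.ofReal t • P₁ + ENNReal.ofReal (1 - t) • P₂)
    (le_iSup_of_le hP (le_iSup_of_le ?_ ?_))
  · rw [lintegral_add_measure, lintegral_smul_measure, lintegral_smul_measure,
      ENNReal.ofReal_add (by positivity) (by positivity), ENNReal.ofReal_mul ht.le,
      ENNReal.ofReal_mul hs.le, smul_eq_mul, smul_eq_mul]
    gcongr
  · have := EReal.coe_ennreal_le_coe_ennreal_iff.2 key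
    rw [EReal.coe_ennreal_add, EReal.coe_ennreal_mul, EReal.coe_ennreal_mul,
      EReal.coe_ennreal_ofReal, EReal.coe_ennreal_ofReal, max_eq_left ht.le,
      max_eq_left hs.le] at this
    exact this
end

section
/- Let W be a real-valued random variable and Y a random variable taking values in a standard Borel space, defined on a common probability space, and let F(y, ·) denote the conditional cumulative distribution function of W given Y = y. If for law(Y)-almost every y the function w ↦ F(y, w) is continuous, then the random variable U := F(Y, W) is uniformly distributed on [0,1] and is independent of Y. -/
open MeasureTheory ProbabilityTheory
open scoped ENNReal

lemma stieltjes_map_uniform (f : StieltjesFunction ℝ) (hc : Continuous f)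
    (h0 : Filter.Tendsto f Filter.atBot (nhds 0)) (h1 : Filter.Tendsto f Filter.atTop (nhds 1)) :
    f.measure.map f = volume.restrict (Set.Icc (0 : ℝ) 1) := by
  have := f.isProbabilityMeasure h0 h1
  have hn : ∀ x, 0 ≤ f x := fun x => f.mono.le_of_tendsto h0 x
  have hl : ∀ x, f x ≤ 1 := fun x => f.mono.ge_of_tendsto h1 x
  have : IsFiniteMeasure (f.measure.map f) := inferInstance
  refine Measure.ext_of_Iic _ _ fun t => ?_
  rw [Measure.map_apply hc.measurable measurableSet_Iic,
    Measure.restrict_apply measurableSet_Iic]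
  rcases lt_or_ge t 0 with ht | ht
  · have e1 : f ⁻¹' Set.Iic t = ∅ := by
      ext x; simp only [Set.mem_preimage, Set.mem_Iic, Set.mem_empty_iff_false, iff_false, not_le]
      exact ht.trans_le (hn x)
    have e2 : Set.Iic t ∩ Set.Icc (0 : ℝ) 1 = ∅ := by
      ext x; simp only [Set.mem_inter_iff, Set.mem_Iic, Set.mem_Icc, Set.mem_empty_iff_false,
        iff_false]
      rintro ⟨a, b, c⟩; linarith
    rw [e1, e2]; simp
  rcases le_or_gt 1 t with ht1 | ht1
  · have e1 : f ⁻¹' Set.Iic t = Set.univ := by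
      ext x; simpa using (hl x).trans ht1
    have e2 : Set.Iic t ∩ Set.Icc (0 : ℝ) 1 = Set.Icc 0 1 := by
      ext x; simp only [Set.mem_inter_iff, Set.mem_Iic, Set.mem_Icc]
      constructor
      · exact fun h => h.2
      · exact fun h => ⟨h.2.trans ht1, h⟩
    rw [e1, e2]; simp
  have e2 : Set.Iic t ∩ Set.Icc (0 : ℝ) 1 = Set.Icc 0 t := by
    ext x; simp only [Set.mem_inter_iff, Set.mem_Iic, Set.mem_Icc]
    constructor
    · exact fun h => ⟨h.2.1, h.1⟩
    · exact fun h => ⟨h.2, h.1, h.2.trans ht1.le⟩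
  rw [e2, Real.volume_Icc, sub_zero]
  rcases (f ⁻¹' Set.Iic t).eq_empty_or_nonempty with he | hne
  · have : t ≤ 0 := by
      refine ge_of_tendsto' h0 fun x => ?_
      by_contra hx
      have : x ∈ f ⁻¹' Set.Iic t := (not_le.1 hx).le
      rw [he] at this; exact this
    rw [he, measure_empty, ENNReal.ofReal_of_nonpos this]
  · obtain ⟨b, hb⟩ := (h1.eventually (lt_mem_nhds ht1)).exists
    have hbdd : BddAbove (f ⁻¹' Set.Iic t) := by
      refine ⟨b, fun x hx => ?_⟩
      by_contra hxb
      have h3 : f b ≤ f x := f.mono (not_le.1 hxb).le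
      have h4 : f x ≤ t := hx
      linarith
    have hmem := (isClosed_Iic.preimage hc).csSup_mem hne hbdd
    set x := sSup (f ⁻¹' Set.Iic t) with hx
    have hxt : f x ≤ t := hmem
    have hA : f ⁻¹' Set.Iic t = Set.Iic x := by
      ext y
      exact ⟨fun hy => le_csSup hbdd hy, fun hy => (f.mono hy).trans hxt⟩
    have hge : t ≤ f x := by
      have h5 : Filter.Tendsto f (nhdsWithin x (Set.Ioi x)) (nhds (f x)) :=
        hc.continuousAt.tendsto.mono_left nhdsWithin_le_nhds
      refine ge_of_tendsto h5 ?_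
      filter_upwards [self_mem_nhdsWithin] with y hy
      by_contra hyt
      have : y ∈ f ⁻¹' Set.Iic t := (not_le.1 hyt).le
      rw [hA] at this
      exact absurd (Set.mem_Iic.1 this) (not_le.2 hy)
    rw [hA, f.measure_Iic h0, sub_zero, le_antisymm hxt hge]

lemma measurable_condCDF_uncurry {α : Type*} [MeasurableSpace α] (ρ : Measure (α × ℝ)) :
    Measurable fun p : α × ℝ => condCDF ρ p.1 p.2 := by
  let κ : Kernel α ℝ := ⟨fun a => (condCDF ρ a).measure, measurable_measure_condCDF ρ⟩
  have : IsMarkovKernel κ := ⟨fun a => instIsProbabilityMeasureCondCDF ρ a⟩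
  have hs : MeasurableSet {q : (α × ℝ) × ℝ | q.2 ≤ q.1.2} :=
    measurableSet_le measurable_snd (measurable_snd.comp measurable_fst)
  have := Kernel.measurable_kernel_prodMk_left (κ := κ.comap (Prod.fst : α × ℝ → α) measurable_fst)
    hs
  convert this.ennreal_toReal using 2 with p
  change _ = ((condCDF ρ p.1).measure (Set.Iic p.2)).toReal
  rw [measure_condCDF_Iic, ENNReal.toReal_ofReal (condCDF_nonneg _ _ _)]

/-- Conditional probability integral transform: let `W` be a real-valued random variable and `Y`
a random variable with values in a standard Borel space, and let `condCDF (law (Y, W)) y` be the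
conditional CDF of `W` given `Y = y`.  If for `law Y`-almost every `y` the conditional CDF
`w ↦ F(y, w)` is continuous, then `U := F(Y, W)` is uniformly distributed on `[0,1]` and
independent of `Y`. -/
theorem condCDF_uniform_and_indep
    {Ω 𝒴 : Type*} [MeasurableSpace Ω] [MeasurableSpace 𝒴] [StandardBorelSpace 𝒴]
    (Pr : Measure Ω) [IsProbabilityMeasure Pr]
    (W : Ω → ℝ) (Y : Ω → 𝒴) (hW : Measurable W) (hY : Measurable Y)
    (hcont : ∀ᵐ y ∂(Pr.map Y),
      Continuous fun w => condCDF (Pr.map fun ω => (Y ω, W ω)) y w) :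
    Pr.map (fun ω => condCDF (Pr.map fun ω' => (Y ω', W ω')) (Y ω) (W ω))
        = volume.restrict (Set.Icc (0 : ℝ) 1) ∧
    IndepFun (fun ω => condCDF (Pr.map fun ω' => (Y ω', W ω')) (Y ω) (W ω)) Y Pr := by
  set ρ := Pr.map fun ω => (Y ω, W ω) with hρ
  have hYW : Measurable fun ω => (Y ω, W ω) := hY.prodMk hW
  have : IsProbabilityMeasure ρ := Measure.isProbabilityMeasure_map hYW.aemeasurable
  have : IsProbabilityMeasure (Pr.map Y) := Measure.isProbabilityMeasure_map hY.aemeasurable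
  have hfst : ρ.fst = Pr.map Y := Measure.fst_map_prodMk hW
  have hF := measurable_condCDF_uncurry ρ
  have hU : Measurable fun ω => condCDF ρ (Y ω) (W ω) := hF.comp hYW
  have : IsProbabilityMeasure (volume.restrict (Set.Icc (0 : ℝ) 1)) := ⟨by simp⟩
  have key : Pr.map (fun ω => (condCDF ρ (Y ω) (W ω), Y ω))
      = (volume.restrict (Set.Icc (0 : ℝ) 1)).prod (Pr.map Y) := by
    symm
    refine Measure.prod_eq fun A B hA hB => ?_
    have hS : MeasurableSet {p : 𝒴 × ℝ | condCDF ρ p.1 p.2 ∈ A ∧ p.1 ∈ B} :=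
      (hF hA).inter (measurable_fst hB)
    rw [Measure.map_apply (hU.prodMk hY) (hA.prod hB)]
    have e : (fun ω => (condCDF ρ (Y ω) (W ω), Y ω)) ⁻¹' (A ×ˢ B)
        = (fun ω => (Y ω, W ω)) ⁻¹' {p : 𝒴 × ℝ | condCDF ρ p.1 p.2 ∈ A ∧ p.1 ∈ B} := rfl
    rw [e, ← Measure.map_apply hYW hS, ← hρ]
    have h1 := lintegral_toKernel_mem (isCondKernelCDF_condCDF ρ) () hS
    simp only [Kernel.const_apply, IsCondKernelCDF.toKernel_apply] at h1
    rw [← h1, hfst]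
    have h2 : ∀ᵐ y ∂(Pr.map Y), (condCDF ρ y).measure
        (Prod.mk y ⁻¹' {p : 𝒴 × ℝ | condCDF ρ p.1 p.2 ∈ A ∧ p.1 ∈ B})
        = B.indicator (fun _ => volume.restrict (Set.Icc (0 : ℝ) 1) A) y := by
      filter_upwards [hcont] with y hy
      by_cases hyB : y ∈ B
      · rw [Set.indicator_of_mem hyB, ← stieltjes_map_uniform (condCDF ρ y) hy
          (tendsto_condCDF_atBot ρ y) (tendsto_condCDF_atTop ρ y),
          Measure.map_apply hy.measurable hA]
        congr 1
        ext w
        simp [hyB]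
      · rw [Set.indicator_of_notMem hyB]
        simp [hyB]
    rw [lintegral_congr_ae h2, lintegral_indicator_const hB]
  have hmap : Pr.map (fun ω => condCDF ρ (Y ω) (W ω)) = volume.restrict (Set.Icc (0 : ℝ) 1) := by
    have := congrArg Measure.fst key
    rwa [Measure.fst_map_prodMk hY, Measure.fst_prod] at this
  refine ⟨hmap, ?_⟩
  rw [indepFun_iff_map_prod_eq_prod_map_map hU.aemeasurable hY.aemeasurable, hmap, key]
end

section
/- Let p ∈ (0,1) and let P be the 3×3 stochastic matrix with rows (p, 1−p, 0), (p/2, 1/2, (1−p)/2), (0, p, 1−p), indexed by states {0,1,2}. Then π = (p², 2p(1−p), (1−p)²) is a stationary distribution for P: Σ_i π(i) P(i,j) = π(j) for all j. Moreover, for p = 1/2, letting κ be the channel from {0,1,2} to {0,1} with κ(0) = δ₀, κ(1) the uniform distribution on {0,1}, and κ(2) = δ₁, the mutual information of the input distribution π = (1/4, 1/2, 1/4) through κ equals (1/2)·log 2; that is, D(π ⊗ κ ‖ π × (κ∘π)) = (1/2)·log 2, where the output marginal κ∘π is uniform on {0,1}. -/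
open MeasureTheory ProbabilityTheory
open scoped ENNReal

theorem klDiv_finite_aux {Ω : Type*} [Fintype Ω] [MeasurableSpace Ω] [MeasurableSingletonClass Ω]
    (P Q : Measure Ω) [IsFiniteMeasure P] [IsFiniteMeasure Q] (hQ : ∀ x, Q {x} ≠ 0) :
    klDiv P Q = ENNReal.ofReal (∑ x, P.real {x} * Real.log (P {x} / Q {x}).toReal) := by
  have hac : P ≪ Q := by
    intro s hs
    have : s = ∅ := by
      by_contra hne
      obtain ⟨x, hx⟩ := Set.nonempty_iff_ne_empty.mpr hne
      exact hQ x (measure_mono_null (Set.singleton_subset_iff.mpr hx) hs)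
    simp [this]
  have hint : Integrable (fun ω => Real.log (P.rnDeriv Q ω).toReal) P := Integrable.of_finite
  have hr : ∀ x, P.rnDeriv Q x = P {x} / Q {x} := by
    intro x
    have h := Measure.setLIntegral_rnDeriv hac {x}
    rw [lintegral_singleton] at h
    rw [← h, ENNReal.mul_div_cancel_right (hQ x) (measure_ne_top _ _)]
  unfold klDiv
  rw [if_pos ⟨hac, hint⟩, integral_fintype hint]
  simp only [hr, smul_eq_mul]

theorem compProd_singleton_aux (μ : Measure (Fin 3)) [IsFiniteMeasure μ] (κ : Kernel (Fin 3) (Fin 2))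
    [IsMarkovKernel κ] (a : Fin 3) (b : Fin 2) : (μ ⊗ₘ κ) {(a, b)} = μ {a} * κ a {b} := by
  rw [← Set.singleton_prod_singleton, Measure.compProd_apply_prod (measurableSet_singleton _)
    (measurableSet_singleton _), lintegral_singleton, mul_comm]

/-- Blackwell trapdoor channel example.  For `p ∈ (0,1)`, the distribution
`π = (p², 2p(1−p), (1−p)²)` is stationary for the state transition matrix
`P = [[p, 1−p, 0], [p/2, 1/2, (1−p)/2], [0, p, 1−p]]`.  Moreover, for `p = 1/2`, with the
channel `κ` from `{0,1,2}` to `{0,1}` given by `κ(0) = δ₀`, `κ(1)` uniform, `κ(2) = δ₁`, and the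
input measure `μπ` with weights `π = (1/4, 1/2, 1/4)`, the output marginal `κ∘μπ` is uniform on
`{0,1}`, and the mutual information `D(μπ ⊗ₘ κ ‖ μπ × (κ∘μπ))` equals `(1/2)·log 2`. -/
theorem trapdoor_stationary_and_mutualInfo
    (p : ℝ) (hp0 : 0 < p) (hp1 : p < 1)
    (P : Fin 3 → Fin 3 → ℝ)
    (hP : P = ![![p, 1 - p, 0], ![p / 2, 1 / 2, (1 - p) / 2], ![0, p, 1 - p]])
    (π : Fin 3 → ℝ) (hπ : π = ![p ^ 2, 2 * p * (1 - p), (1 - p) ^ 2]) :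
    (∀ j, ∑ i, π i * P i j = π j) ∧
    (p = 1 / 2 →
      ∀ κ : Kernel (Fin 3) (Fin 2),
        κ 0 = Measure.dirac 0 →
        κ 1 = (1 / 2 : ℝ≥0∞) • Measure.dirac 0 + (1 / 2 : ℝ≥0∞) • Measure.dirac 1 →
        κ 2 = Measure.dirac 1 →
        ∀ μπ : Measure (Fin 3),
          μπ = ENNReal.ofReal (π 0) • Measure.dirac 0 + ENNReal.ofReal (π 1) • Measure.dirac 1
              + ENNReal.ofReal (π 2) • Measure.dirac 2 →
          μπ.bind κ = (1 / 2 : ℝ≥0∞) • Measure.dirac 0 + (1 / 2 : ℝ≥0∞) • Measure.dirac 1 ∧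
          klDiv (μπ ⊗ₘ κ) (μπ.prod (μπ.bind κ))
            = ENNReal.ofReal ((1 / 2) * Real.log 2)) := by
  refine ⟨?_, ?_⟩
  · intro j
    subst hP hπ
    fin_cases j <;> simp [Fin.sum_univ_three] <;> ring
  · intro hp κ h0 h1 h2 μ hμ
    have e0 : ENNReal.ofReal (π 0) = 1 / 4 := by
      rw [hπ, hp]
      rw [show (![(1 / 2 : ℝ) ^ 2, 2 * (1 / 2) * (1 - 1 / 2), (1 - 1 / 2) ^ 2] 0) = 4⁻¹ by norm_num]
      rw [ENNReal.ofReal_inv_of_pos (by norm_num)]; simp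
    have e1 : ENNReal.ofReal (π 1) = 1 / 2 := by
      rw [hπ, hp]
      rw [show (![(1 / 2 : ℝ) ^ 2, 2 * (1 / 2) * (1 - 1 / 2), (1 - 1 / 2) ^ 2] 1) = 2⁻¹ by norm_num]
      rw [ENNReal.ofReal_inv_of_pos (by norm_num)]; simp
    have e2 : ENNReal.ofReal (π 2) = 1 / 4 := by
      rw [hπ, hp]
      rw [show (![(1 / 2 : ℝ) ^ 2, 2 * (1 / 2) * (1 - 1 / 2), (1 - 1 / 2) ^ 2] 2) = 4⁻¹ by simp; norm_num]
      rw [ENNReal.ofReal_inv_of_pos (by norm_num)]; simp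
    rw [e0, e1, e2] at hμ
    have hM : IsMarkovKernel κ := by
      constructor
      intro a
      constructor
      fin_cases a
      · simp [h0]
      · simp [h1, ENNReal.inv_two_add_inv_two]
      · simp [h2]
    have q : (4⁻¹ : ℝ≥0∞) + 2⁻¹ * 2⁻¹ = 2⁻¹ := by
      rw [← ENNReal.toReal_eq_toReal_iff' (by finiteness) (by finiteness),
        ENNReal.toReal_add (by finiteness) (by finiteness)]
      simp; norm_num
    have hb : μ.bind κ = (1 / 2 : ℝ≥0∞) • Measure.dirac 0 + (1 / 2 : ℝ≥0∞) • Measure.dirac 1 := by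
      refine Measure.ext_of_singleton fun b => ?_
      rw [Measure.bind_apply (measurableSet_singleton _) κ.measurable.aemeasurable, hμ]
      fin_cases b <;> simp [h0, h1, h2, q, add_comm (2⁻¹ * 2⁻¹ : ℝ≥0∞)]
    have hF : IsFiniteMeasure μ := by
      constructor
      rw [hμ]
      simp
    have m0 : μ {0} = 4⁻¹ := by simp [hμ]
    have m1 : μ {1} = 2⁻¹ := by simp [hμ]
    have m2 : μ {2} = 4⁻¹ := by simp [hμ]
    have b0 : (μ.bind κ) {0} = 2⁻¹ := by simp [hb]
    have b1 : (μ.bind κ) {1} = 2⁻¹ := by simp [hb]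
    have hQ : ∀ a b, (μ.prod (μ.bind κ)) {(a, b)} = μ {a} * (μ.bind κ) {b} := by
      intro a b
      rw [← Set.singleton_prod_singleton, Measure.prod_prod]
    refine ⟨hb, ?_⟩
    rw [klDiv_finite_aux]
    · congr 1
      simp only [Fintype.sum_prod_type, Fin.sum_univ_three, Fin.sum_univ_two, hQ, measureReal_def,
        compProd_singleton_aux, m0, m1, m2, b0, b1, h0, h1, h2]
      simp
      norm_num
      try ring
    · rintro ⟨a, b⟩
      rw [hQ]
      fin_cases a <;> fin_cases b <;> simp [m0, m1, m2, b0, b1]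
end

section
/- Let n ≥ 1, ρ ∈ ℝ, c ∈ ℝ, σ² ≥ 0, and let (W_i)_{0≤i≤n}, (Z_i)_{0≤i≤n}, (W̃_i)_{1≤i≤n} be square-integrable real-valued random variables on a probability space satisfying, for each 1 ≤ i ≤ n: W_i = ρ·W_{i−1} + W̃_i, E[W̃_i·(W_{i−1} − Z_{i−1})] = 0, and E[W̃_i²] = σ². Then E[Σ_{i=1}^n ((W_i − Z_i)² − c·(W_i − ρ·Z_{i−1})²)] = (1 − ρ²c)·Σ_{i=1}^{n} E[(W_i − Z_i)²] + ρ²c·E[(W_n − Z_n)²] − ρ²c·E[(W_0 − Z_0)²] − n·c·σ². -/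
open MeasureTheory

/-- Telescoping expectation identity for the Gauss–Markov inverse-optimal-control cost.
If `W_i = ρW_{i−1} + W̃_i` with innovations `W̃_i` orthogonal to the previous estimation error
`W_{i−1} − Z_{i−1}` and `E[W̃_i²] = σ²`, then
`E[Σ_{i=1}^n ((W_i − Z_i)² − c(W_i − ρZ_{i−1})²)]
 = (1 − ρ²c)·Σ_{i=1}^n E[(W_i − Z_i)²] + ρ²c·E[(W_n − Z_n)²] − ρ²c·E[(W_0 − Z_0)²] − ncσ²`. -/
theorem gauss_markov_telescoping_cost
    {Ω : Type*} [MeasurableSpace Ω] (Pr : Measure Ω) [IsProbabilityMeasure Pr]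
    (n : ℕ) (hn : 1 ≤ n) (ρ c σ2 : ℝ) (hσ2 : 0 ≤ σ2)
    (W Z Wt : ℕ → Ω → ℝ)
    (hW : ∀ i ≤ n, MemLp (W i) 2 Pr)
    (hZ : ∀ i ≤ n, MemLp (Z i) 2 Pr)
    (hWt : ∀ i, 1 ≤ i → i ≤ n → MemLp (Wt i) 2 Pr)
    (hrec : ∀ i < n, ∀ ω, W (i + 1) ω = ρ * W i ω + Wt (i + 1) ω)
    (horth : ∀ i < n, ∫ ω, Wt (i + 1) ω * (W i ω - Z i ω) ∂Pr = 0)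
    (hvar : ∀ i < n, ∫ ω, (Wt (i + 1) ω) ^ 2 ∂Pr = σ2) :
    ∫ ω, (∑ i ∈ Finset.range n,
        ((W (i + 1) ω - Z (i + 1) ω) ^ 2 - c * (W (i + 1) ω - ρ * Z i ω) ^ 2)) ∂Pr
      = (1 - ρ ^ 2 * c) * ∑ i ∈ Finset.range n, ∫ ω, (W (i + 1) ω - Z (i + 1) ω) ^ 2 ∂Pr
        + ρ ^ 2 * c * ∫ ω, (W n ω - Z n ω) ^ 2 ∂Pr
        - ρ ^ 2 * c * ∫ ω, (W 0 ω - Z 0 ω) ^ 2 ∂Pr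
        - n * c * σ2 := by
  have hD : ∀ i ≤ n, Integrable (fun ω => (W i ω - Z i ω) ^ 2) Pr := fun i hi =>
    ((hW i hi).sub (hZ i hi)).integrable_sq
  have hV : ∀ i < n, Integrable (fun ω => (Wt (i + 1) ω) ^ 2) Pr := fun i hi =>
    (hWt (i + 1) (by omega) hi).integrable_sq
  have hX : ∀ i < n, Integrable (fun ω => Wt (i + 1) ω * (W i ω - Z i ω)) Pr := fun i hi =>
    (hWt (i + 1) (by omega) hi).integrable_mul ((hW i hi.le).sub (hZ i hi.le))
  have hpt : ∀ i < n, (fun ω => (W (i + 1) ω - ρ * Z i ω) ^ 2) =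
      fun ω => ρ ^ 2 * (W i ω - Z i ω) ^ 2 + 2 * ρ * (Wt (i + 1) ω * (W i ω - Z i ω))
        + (Wt (i + 1) ω) ^ 2 := by
    intro i hi
    funext ω
    rw [hrec i hi ω]
    ring
  have hE : ∀ i < n, Integrable (fun ω => (W (i + 1) ω - ρ * Z i ω) ^ 2) Pr := by
    intro i hi
    rw [hpt i hi]
    exact (((hD i hi.le).const_mul _).add ((hX i hi).const_mul _)).add (hV i hi)
  have hEv : ∀ i < n, ∫ ω, (W (i + 1) ω - ρ * Z i ω) ^ 2 ∂Pr
      = ρ ^ 2 * ∫ ω, (W i ω - Z i ω) ^ 2 ∂Pr + σ2 := by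
    intro i hi
    have h1 : Integrable (fun ω => ρ ^ 2 * (W i ω - Z i ω) ^ 2
        + 2 * ρ * (Wt (i + 1) ω * (W i ω - Z i ω))) Pr :=
      ((hD i hi.le).const_mul _).add ((hX i hi).const_mul _)
    rw [hpt i hi, integral_add h1 (hV i hi),
      integral_add ((hD i hi.le).const_mul _) ((hX i hi).const_mul _),
      integral_const_mul, integral_const_mul, horth i hi, hvar i hi]
    ring
  have hI : ∀ i ∈ Finset.range n, Integrable (fun ω =>
      (W (i + 1) ω - Z (i + 1) ω) ^ 2 - c * (W (i + 1) ω - ρ * Z i ω) ^ 2) Pr := fun i hi =>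
    (hD (i + 1) (Finset.mem_range.1 hi)).sub ((hE i (Finset.mem_range.1 hi)).const_mul c)
  rw [integral_finsetSum _ hI]
  have hterm : ∀ i ∈ Finset.range n,
      ∫ ω, ((W (i + 1) ω - Z (i + 1) ω) ^ 2 - c * (W (i + 1) ω - ρ * Z i ω) ^ 2) ∂Pr
      = (1 - ρ ^ 2 * c) * ∫ ω, (W (i + 1) ω - Z (i + 1) ω) ^ 2 ∂Pr
        + ρ ^ 2 * c * (∫ ω, (W (i + 1) ω - Z (i + 1) ω) ^ 2 ∂Pr - ∫ ω, (W i ω - Z i ω) ^ 2 ∂Pr)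
        - c * σ2 := by
    intro i hi
    have hi := Finset.mem_range.1 hi
    rw [integral_sub (hD (i + 1) hi) ((hE i hi).const_mul c), integral_const_mul, hEv i hi]
    ring
  rw [Finset.sum_congr rfl hterm, Finset.sum_sub_distrib, Finset.sum_add_distrib,
    ← Finset.mul_sum, ← Finset.mul_sum,
    Finset.sum_range_sub (fun i => ∫ ω, (W i ω - Z i ω) ^ 2 ∂Pr)]
  simp only [Finset.sum_const, Finset.card_range, nsmul_eq_mul]
  ring
end

section
/- Let n ≥ 1, let W, X_1, …, X_n, Y_1, …, Y_n be random variables on a probability space taking values in standard Borel spaces 𝒲, 𝒳, 𝒴, and let κ be a Markov kernel from 𝒳 to 𝒴. Suppose the channel is memoryless and non-anticipative: a regular conditional distribution of (Y_1, …, Y_n) given (W, X_1, …, X_n) = (w, x_1, …, x_n) is the product measure κ(x_1) × κ(x_2) × ⋯ × κ(x_n). Then I(W; (Y_1, …, Y_n)) ≤ Σ_{i=1}^n I(X_i; Y_i). -/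
open MeasureTheory ProbabilityTheory
open scoped ENNReal

lemma aux_klDiv_eq {Ω : Type*} [MeasurableSpace Ω] (P Q : Measure Ω) [IsProbabilityMeasure P]
    [IsProbabilityMeasure Q] : klDiv P Q = InformationTheory.klDiv P Q := by
  classical
  unfold klDiv
  rw [InformationTheory.klDiv_def]
  simp [llr, llr_def]

/-- splitting off one coordinate -/
lemma aux_split {S 𝒴 : Type*} [MeasurableSpace S] [MeasurableSpace 𝒴] {n : ℕ}
    (P : Measure S) [IsProbabilityMeasure P] (κ : Fin (n + 1) → Kernel S 𝒴)
    [∀ i, IsMarkovKernel (κ i)] (η : Kernel S (Fin (n + 1) → 𝒴)) [IsMarkovKernel η]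
    (hη : ∀ s, η s = Measure.pi fun i => κ i s)
    (η' : Kernel S (Fin n → 𝒴)) [IsMarkovKernel η']
    (hη' : ∀ s, η' s = Measure.pi fun i => κ i.succ s) :
    P ⊗ₘ η = ((P ⊗ₘ κ 0) ⊗ₘ (η'.comap Prod.fst measurable_fst)).map
      (fun q => (q.1.1, (MeasurableEquiv.piFinSuccAbove (fun _ => 𝒴) 0).symm (q.1.2, q.2))) := by
  have hm : Measurable (fun q : (S × 𝒴) × (Fin n → 𝒴) =>
      (q.1.1, (MeasurableEquiv.piFinSuccAbove (fun _ : Fin (n+1) => 𝒴) 0).symm (q.1.2, q.2))) := by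
    fun_prop
  ext A hA
  rw [Measure.map_apply hm hA, Measure.compProd_apply hA, Measure.compProd_apply (hm hA),
    Measure.lintegral_compProd]
  · refine lintegral_congr fun s => ?_
    have h1 : η s = ((κ 0 s).prod (η' s)).map
        (MeasurableEquiv.piFinSuccAbove (fun _ : Fin (n+1) => 𝒴) 0).symm := by
      rw [hη, hη']
      have := (measurePreserving_piFinSuccAbove (fun i => κ i s) 0).symm.map_eq
      simpa using this.symm
    rw [h1, Measure.map_apply (by fun_prop) (measurable_prodMk_left hA), Measure.prod_apply]
    · rfl
    · exact (MeasurableEquiv.measurable _) (measurable_prodMk_left hA)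
  · exact Kernel.measurable_kernel_prodMk_left (hm hA)

lemma aux_swap {S 𝒴 𝒵 : Type*} [MeasurableSpace S] [MeasurableSpace 𝒴] [MeasurableSpace 𝒵]
    (P : Measure S) [IsProbabilityMeasure P] (κ : Kernel S 𝒴) (η : Kernel S 𝒵)
    [IsMarkovKernel κ] [IsMarkovKernel η] :
    (P ⊗ₘ κ) ⊗ₘ (η.comap Prod.fst measurable_fst) =
      ((P ⊗ₘ η) ⊗ₘ (κ.comap Prod.fst measurable_fst)).map (fun q => ((q.1.1, q.2), q.1.2)) := by
  have hm : Measurable (fun q : (S × 𝒵) × 𝒴 => ((q.1.1, q.2), q.1.2)) := by fun_prop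
  ext A hA
  rw [Measure.map_apply hm hA, Measure.compProd_apply hA, Measure.compProd_apply (hm hA),
    Measure.lintegral_compProd, Measure.lintegral_compProd]
  · refine lintegral_congr fun s => ?_
    have hA' : MeasurableSet ((fun q : 𝒴 × 𝒵 => ((s, q.1), q.2)) ⁻¹' A) :=
      (by fun_prop : Measurable (fun q : 𝒴 × 𝒵 => ((s, q.1), q.2))) hA
    have := Measure.prod_apply (μ := κ s) (ν := η s) hA'
    have h2 := Measure.prod_apply_symm (μ := κ s) (ν := η s) hA'
    rw [this] at h2
    exact h2
  · exact Kernel.measurable_kernel_prodMk_left (hm hA)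
  · exact Kernel.measurable_kernel_prodMk_left hA

open InformationTheory in
lemma aux_tensor {S 𝒴 : Type*} [MeasurableSpace S] [MeasurableSpace 𝒴]
    (P : Measure S) [IsProbabilityMeasure P] : ∀ (n : ℕ) (κ : Fin n → Kernel S 𝒴)
    (_ : ∀ i, IsMarkovKernel (κ i)) (ν : Fin n → Measure 𝒴) (_ : ∀ i, IsProbabilityMeasure (ν i))
    (η : Kernel S (Fin n → 𝒴)) (_ : IsMarkovKernel η)
    (_ : ∀ s, η s = Measure.pi fun i => κ i s),
    InformationTheory.klDiv (P ⊗ₘ η) (P.prod (Measure.pi ν)) ≤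
      ∑ i, InformationTheory.klDiv (P ⊗ₘ κ i) (P.prod (ν i)) := by
  intro n
  induction n with
  | zero =>
    intro κ _ ν _ η _ hη
    have : η = Kernel.const _ (Measure.pi ν) := by
      ext1 s
      rw [hη, Kernel.const_apply, Measure.pi_of_empty, Measure.pi_of_empty]
    rw [this, Measure.compProd_const]
    simp
  | succ n ih =>
    intro κ _ ν _ η _ hη
    have htail : ∀ s, (η.map (fun y (i : Fin n) => y i.succ)) s
        = Measure.pi fun i => κ i.succ s := by
      intro s
      rw [Kernel.map_apply _ (by fun_prop), hη]
      have h1 := (measurePreserving_piFinSuccAbove (fun i => κ i s) 0).map_eq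
      have h2 := congrArg (Measure.map Prod.snd) h1
      rw [Measure.map_map (by fun_prop) (by fun_prop)] at h2
      simp only [Measure.map_snd_prod, measure_univ, one_smul] at h2
      exact h2
    set η' := η.map (fun y (i : Fin n) => y i.succ) with hη'
    have : IsMarkovKernel η' := Kernel.IsMarkovKernel.map _ (by fun_prop)
    have e1 := aux_split P κ η hη η' htail
    have e2 := aux_split P (fun i => Kernel.const S (ν i)) (Kernel.const S (Measure.pi ν))
      (fun s => by simp) (Kernel.const S (Measure.pi fun i => ν i.succ)) (fun s => by simp)
    rw [← Measure.compProd_const, e1, e2, Fin.sum_univ_succ]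
    refine (klDiv_map_le _ _ (by fun_prop)).trans ?_
    rw [klDiv_compProd_eq_add, Measure.compProd_const]
    gcongr
    rw [aux_swap P (κ 0) η', aux_swap P (κ 0) (Kernel.const S (Measure.pi fun i : Fin n => ν i.succ))]
    refine (klDiv_map_le _ _ (by fun_prop)).trans ?_
    rw [klDiv_compProd_left, Measure.compProd_const]
    exact ih _ (fun _ => inferInstance) _ (fun _ => inferInstance) _ inferInstance htail

open InformationTheory in
lemma aux_marg {S 𝒳 𝒴 : Type*} [MeasurableSpace S] [StandardBorelSpace S] [MeasurableSpace 𝒳]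
    [MeasurableSpace 𝒴]
    (P : Measure S) [IsProbabilityMeasure P] (f : S → 𝒳) (hf : Measurable f)
    (κ : Kernel 𝒳 𝒴) [IsMarkovKernel κ] (ν : Measure 𝒴) [IsProbabilityMeasure ν] :
    InformationTheory.klDiv (P ⊗ₘ κ.comap f hf) (P.prod ν) ≤
      InformationTheory.klDiv ((P.map f) ⊗ₘ κ) ((P.map f).prod ν) := by
  have : Nonempty S := nonempty_of_isProbabilityMeasure P
  have : IsProbabilityMeasure (P.map f) := Measure.isProbabilityMeasure_map hf.aemeasurable
  set ρ := condDistrib id f P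
  have hρ : P.map f ⊗ₘ ρ = P.map (fun s => (f s, s)) :=
    compProd_map_condDistrib aemeasurable_id
  have key : ∀ (κ : Kernel 𝒳 𝒴) [IsMarkovKernel κ], P ⊗ₘ κ.comap f hf =
      ((P.map f ⊗ₘ κ) ⊗ₘ ρ.comap Prod.fst measurable_fst).map (fun q => (q.2, q.1.2)) := by
    intro κ _
    rw [aux_swap, hρ, Measure.map_map (by fun_prop) (by fun_prop)]
    have hm : Measurable ((fun q : (𝒳 × 𝒴) × S ↦ (q.2, q.1.2)) ∘
      (fun q : (𝒳 × S) × 𝒴 ↦ ((q.1.1, q.2), q.1.2))) := by fun_prop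
    ext A hA
    rw [Measure.map_apply hm hA, Measure.compProd_apply hA, Measure.compProd_apply (hm hA),
      lintegral_map _ (by fun_prop)]
    · rfl
    · exact Kernel.measurable_kernel_prodMk_left (hm hA)
  have e2 := key (Kernel.const _ ν)
  have ec : (Kernel.const 𝒳 ν).comap f hf = Kernel.const S ν := rfl
  rw [ec, Measure.compProd_const, Measure.compProd_const] at e2
  rw [key κ, e2]
  refine (klDiv_map_le _ _ (by fun_prop)).trans ?_
  rw [klDiv_compProd_left]

open InformationTheory in
/-- golden formula -/
lemma aux_golden {S 𝒴 : Type*} [MeasurableSpace S] [StandardBorelSpace S]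
    [MeasurableSpace 𝒴] (J : Measure (S × 𝒴)) [IsProbabilityMeasure J] (q : Measure 𝒴)
    [IsProbabilityMeasure q] :
    InformationTheory.klDiv J (J.fst.prod J.snd) ≤ InformationTheory.klDiv J (J.fst.prod q) := by
  have : Nonempty S := (nonempty_of_isProbabilityMeasure J).map Prod.fst
  set ρ := (J.map Prod.swap).condKernel
  have h1 : J.snd ⊗ₘ ρ = J.map Prod.swap := by
    rw [← Measure.fst_map_swap]; exact Measure.disintegrate _ _
  have h2 : J = (J.snd ⊗ₘ ρ).map Prod.swap := by
    rw [h1, Measure.map_map (by fun_prop) (by fun_prop)]; simp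
  calc InformationTheory.klDiv J (J.fst.prod J.snd)
      = InformationTheory.klDiv ((J.snd ⊗ₘ ρ).map Prod.swap)
        ((J.snd.prod J.fst).map Prod.swap) := by rw [← h2, Measure.prod_swap]
    _ ≤ InformationTheory.klDiv (J.snd ⊗ₘ ρ) (J.snd ⊗ₘ Kernel.const _ J.fst) := by
        rw [Measure.compProd_const]; exact klDiv_map_le _ _ (by fun_prop)
    _ ≤ InformationTheory.klDiv (J.snd ⊗ₘ ρ) (q ⊗ₘ Kernel.const _ J.fst) := by
        rw [klDiv_compProd_eq_add J.snd q]; exact le_add_self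
    _ = InformationTheory.klDiv (J.map Prod.swap) ((J.fst.prod q).map Prod.swap) := by
        rw [h1, Measure.compProd_const, Measure.prod_swap]
    _ ≤ _ := klDiv_map_le _ _ (by fun_prop)

/-- For a memoryless non-anticipative channel, the end-to-end mutual information is bounded by
the sum of single-letter mutual informations: if a regular conditional distribution of
`(Y_1,…,Y_n)` given `(W, X_1,…,X_n) = (w, x_1,…,x_n)` is the product measure
`κ(x_1) × ⋯ × κ(x_n)`, then `I(W; (Y_1,…,Y_n)) ≤ Σ_{i=1}^n I(X_i; Y_i)`, where
`I(U;V) = D(law (U,V) ‖ law U × law V)`. -/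
theorem mutualInfo_le_sum_single_letter
    {Ω 𝒲 𝒳 𝒴 : Type*} [MeasurableSpace Ω]
    [MeasurableSpace 𝒲] [StandardBorelSpace 𝒲]
    [MeasurableSpace 𝒳] [StandardBorelSpace 𝒳]
    [MeasurableSpace 𝒴] [StandardBorelSpace 𝒴]
    (Pr : Measure Ω) [IsProbabilityMeasure Pr]
    (n : ℕ) (hn : 1 ≤ n)
    (W : Ω → 𝒲) (X : Fin n → Ω → 𝒳) (Y : Fin n → Ω → 𝒴)
    (hW : Measurable W) (hX : ∀ i, Measurable (X i)) (hY : ∀ i, Measurable (Y i))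
    (κ : Kernel 𝒳 𝒴) [IsMarkovKernel κ]
    (η : Kernel (𝒲 × (Fin n → 𝒳)) (Fin n → 𝒴)) [IsMarkovKernel η]
    (hη : ∀ q : 𝒲 × (Fin n → 𝒳), η q = Measure.pi fun i => κ (q.2 i))
    (hdis : Pr.map (fun ω => ((W ω, fun i => X i ω), fun i => Y i ω))
        = (Pr.map fun ω => (W ω, fun i => X i ω)) ⊗ₘ η) :
    klDiv (Pr.map fun ω => (W ω, fun i => Y i ω))
        ((Pr.map W).prod (Pr.map fun ω => fun i => Y i ω))
      ≤ ∑ i, klDiv (Pr.map fun ω => (X i ω, Y i ω)) ((Pr.map (X i)).prod (Pr.map (Y i))) := by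
  have hWX : Measurable (fun ω => (W ω, fun i => X i ω)) := by fun_prop
  have hYm : Measurable (fun ω => fun i => Y i ω) := by fun_prop
  have hpW : IsProbabilityMeasure (Pr.map W) := Measure.isProbabilityMeasure_map hW.aemeasurable
  have hpX : ∀ i, IsProbabilityMeasure (Pr.map (X i)) :=
    fun i => Measure.isProbabilityMeasure_map (hX i).aemeasurable
  have hpY : ∀ i, IsProbabilityMeasure (Pr.map (Y i)) :=
    fun i => Measure.isProbabilityMeasure_map (hY i).aemeasurable
  have hpYm : IsProbabilityMeasure (Pr.map fun ω => fun i => Y i ω) :=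
    Measure.isProbabilityMeasure_map hYm.aemeasurable
  have hpWX : IsProbabilityMeasure (Pr.map fun ω => (W ω, fun i => X i ω)) :=
    Measure.isProbabilityMeasure_map hWX.aemeasurable
  have hpWY : IsProbabilityMeasure (Pr.map fun ω => (W ω, fun i => Y i ω)) :=
    Measure.isProbabilityMeasure_map (by fun_prop)
  have hpXY : ∀ i, IsProbabilityMeasure (Pr.map fun ω => (X i ω, Y i ω)) :=
    fun i => Measure.isProbabilityMeasure_map (by fun_prop)
  rw [aux_klDiv_eq]
  simp_rw [aux_klDiv_eq]
  set P := Pr.map fun ω => (W ω, fun i => X i ω) with hP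
  have hsnd : (P ⊗ₘ η).snd = Pr.map fun ω => fun i => Y i ω := by
    rw [← hdis, Measure.snd_map_prodMk (by fun_prop)]
  have hgold := aux_golden (P ⊗ₘ η) (Measure.pi fun i => Pr.map (Y i))
  rw [Measure.fst_compProd, hsnd] at hgold
  have hf : ∀ i, Measurable (fun q : 𝒲 × (Fin n → 𝒳) => q.2 i) := fun i => by fun_prop
  have htens := aux_tensor P n (fun i => κ.comap (fun q => q.2 i) (hf i))
    (fun _ => inferInstance) (fun i => Pr.map (Y i)) hpY η inferInstance (fun s => by
      rw [hη]; rfl)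
  have hjoint : ∀ i, Pr.map (fun ω => (X i ω, Y i ω)) = Pr.map (X i) ⊗ₘ κ := by
    intro i
    have e : Pr.map (fun ω => (X i ω, Y i ω)) = (P ⊗ₘ η).map (fun q => (q.1.2 i, q.2 i)) := by
      rw [← hdis, Measure.map_map (by fun_prop) (by fun_prop)]; rfl
    have e' : Pr.map (X i) = P.map (fun q => q.2 i) := by
      rw [hP, Measure.map_map (by fun_prop) (by fun_prop)]; rfl
    have hm : Measurable (fun q : (𝒲 × (Fin n → 𝒳)) × (Fin n → 𝒴) => (q.1.2 i, q.2 i)) := by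
      fun_prop
    rw [e, e']
    ext A hA
    rw [Measure.map_apply hm hA, Measure.compProd_apply hA, Measure.compProd_apply (hm hA),
      lintegral_map (Kernel.measurable_kernel_prodMk_left hA) (by fun_prop)]
    refine lintegral_congr fun q => ?_
    have h1 := (measurePreserving_eval (fun i => κ (q.2 i)) i).map_eq
    rw [hη, ← h1, Measure.map_apply (by fun_prop) (measurable_prodMk_left hA)]
    rfl
  have hDPI : InformationTheory.klDiv (Pr.map fun ω => (W ω, fun i => Y i ω))
        ((Pr.map W).prod (Pr.map fun ω => fun i => Y i ω)) ≤
      InformationTheory.klDiv (P ⊗ₘ η) (P.prod (Pr.map fun ω => fun i => Y i ω)) := by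
    have e1 : (Pr.map fun ω => (W ω, fun i => Y i ω)) =
        (P ⊗ₘ η).map (Prod.map Prod.fst id) := by
      rw [← hdis, Measure.map_map (by fun_prop) (by fun_prop)]; rfl
    have e2 : (Pr.map W).prod (Pr.map fun ω => fun i => Y i ω) =
        (P.prod (Pr.map fun ω => fun i => Y i ω)).map (Prod.map Prod.fst id) := by
      rw [← Measure.map_prod_map _ _ (by fun_prop) (by fun_prop), Measure.map_id, hP,
        Measure.map_map (by fun_prop) (by fun_prop)]
      rfl
    rw [e1, e2]
    exact InformationTheory.klDiv_map_le _ _ (by fun_prop)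
  refine hDPI.trans (hgold.trans (htens.trans (Finset.sum_le_sum fun i _ => ?_)))
  have hmarg := aux_marg P (fun q => q.2 i) (hf i) κ (Pr.map (Y i))
  have e' : P.map (fun q => q.2 i) = Pr.map (X i) := by
    rw [hP, Measure.map_map (by fun_prop) (by fun_prop)]; rfl
  rw [e'] at hmarg
  rw [hjoint i]
  exact hmarg
end
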